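/- Let d_S ≤ d with d_S odd and d₀ = d − d_S, and let U_d be the bipartite unitary on ℂ^d⊗ℂ^d defined by U_d|a⟩|b⟩ = U_S|a⟩|b⟩ if a,b < d_S and U_d|a⟩|b⟩ = |a⟩|b⟩ otherwise, with Choi state ρ_{ABCD,d}. Then (i) the reduced state ρ_{AD,d} is maximally mixed; (ii) ‖ρ_{AC,d} − τ_{AC}‖₁ ≤ 8 d₀/d; and (iii) if d_S < d, the residual channel N_{A→C}(σ_A) = tr_D[U_d(σ_A ⊗ τ_B)U_d†] satisfies ‖N_{A→C} − Δ_{A→C}‖_⋄ ≥ 2 − 2/d, where Δ_{A→C} is the completely depolarizing channel σ ↦ τ_C. -/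

import Mathlib

open Matrix Kronecker Filter
open scoped BigOperators Classical ComplexOrder

noncomputable section

namespace Scrambling

/-- The maximally mixed state on a finite-dimensional system `X`. -/
def mmState (X : Type*) [Fintype X] [DecidableEq X] : Matrix X X ℂ :=
  (Fintype.card X : ℂ)⁻¹ • 1

/-- A (possibly rectangular) matrix is unitary if `U Uᴴ = 1` and `Uᴴ U = 1`. -/
def IsUnitaryMat {m n : Type*} [Fintype m] [Fintype n] [DecidableEq m] [DecidableEq n]
    (U : Matrix m n ℂ) : Prop :=
  U * Uᴴ = 1 ∧ Uᴴ * U = 1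

/-- Reduced density matrix of a pure state `ψ` on `X ⊗ Y`, tracing out `Y`. -/
def redDM {X Y : Type*} [Fintype Y] (ψ : X × Y → ℂ) : Matrix X X ℂ :=
  Matrix.of fun x x' => ∑ y, ψ (x, y) * star (ψ (x', y))

/-- Base-2 von Neumann entropy of a (Hermitian) matrix: `S(ρ) = -tr (ρ log₂ ρ)`,
computed via the eigenvalues. Junk value `0` for non-Hermitian matrices. -/
def vNE {n : Type*} [Fintype n] [DecidableEq n] (ρ : Matrix n n ℂ) : ℝ :=
  if h : ρ.IsHermitian then (∑ i, Real.negMulLog (h.eigenvalues i)) / Real.log 2 else 0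

/-- Trace norm `‖X‖₁ = tr √(XᴴX)`, via the eigenvalues of `XᴴX`. -/
def traceNorm {n : Type*} [Fintype n] [DecidableEq n] (X : Matrix n n ℂ) : ℝ :=
  ∑ i, Real.sqrt ((Matrix.posSemidef_conjTranspose_mul_self X).1.eigenvalues i)

/-- Density matrix: positive semidefinite with unit trace. -/
def IsDensityMatrix {n : Type*} [Fintype n] (ρ : Matrix n n ℂ) : Prop :=
  ρ.PosSemidef ∧ ρ.trace = 1

/-- The pure density matrix `|ψ⟩⟨ψ|` associated to a state vector. -/
def pureDM {T : Type*} (ψ : T → ℂ) : Matrix T T ℂ :=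
  Matrix.of fun x y => ψ x * star (ψ y)

/-- Extension `id_R ⊗ Φ` of a (linear) map `Φ` on matrices to a reference system `R`. -/
def extendCh {R A C : Type*} (Φ : Matrix A A ℂ → Matrix C C ℂ)
    (ρ : Matrix (R × A) (R × A) ℂ) : Matrix (R × C) (R × C) ℂ :=
  Matrix.of fun p q => Φ (Matrix.of fun x y => ρ (p.1, x) (q.1, y)) p.2 q.2

/-- Diamond-norm distance between two (linear) maps on matrices:
the supremum over all finite-dimensional reference systems `R = Fin n` and all density
matrices `ρ` on `R ⊗ A` of the trace norm of the difference of the extended outputs. -/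
def diamondDist {A C : Type*} [Fintype A] [DecidableEq A] [Fintype C] [DecidableEq C]
    (Φ Ψ : Matrix A A ℂ → Matrix C C ℂ) : ℝ :=
  sSup {x | ∃ (n : ℕ) (ρ : Matrix (Fin n × A) (Fin n × A) ℂ),
    IsDensityMatrix ρ ∧ x = traceNorm (extendCh Φ ρ - extendCh Ψ ρ)}

/-- The unitary quantum channel `σ ↦ U σ Uᴴ`. -/
def uChannel {m n : Type*} [Fintype m] [Fintype n] (U : Matrix m n ℂ) : Matrix n n ℂ → Matrix m m ℂ :=
  fun σ => U * σ * Uᴴ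

/-- The completely depolarizing channel `σ ↦ tr(σ) · τ_C`. -/
def depol (A C : Type*) [Fintype A] [Fintype C] [DecidableEq C] :
    Matrix A A ℂ → Matrix C C ℂ :=
  fun σ => σ.trace • mmState C

section FourParty

variable {A B C D : Type*} [Fintype A] [Fintype B] [Fintype C] [Fintype D]
  [DecidableEq A] [DecidableEq B] [DecidableEq C] [DecidableEq D]

/-- State vector of the Choi state of a bipartite unitary `U : AB → CD`:
`|U⟩ = (1 ⊗ U)(|Φ⁺⟩_{AA'} ⊗ |Φ⁺⟩_{BB'})`. -/
def choiVec (U : Matrix (C × D) (A × B) ℂ) : (A × B) × C × D → ℂ :=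
  fun p => (Real.sqrt (Fintype.card A * Fintype.card B) : ℂ)⁻¹ * U p.2 p.1

/-- Density matrix of the Choi state of a bipartite unitary. -/
def choiDM (U : Matrix (C × D) (A × B) ℂ) :
    Matrix ((A × B) × C × D) ((A × B) × C × D) ℂ :=
  pureDM (choiVec U)

variable (ψ : (A × B) × C × D → ℂ)

/-- Reduced density matrices of a four-party pure state on `A ⊗ B ⊗ C ⊗ D`. -/
def rhoA : Matrix A A ℂ :=
  redDM fun p : A × (B × C × D) => ψ ((p.1, p.2.1), (p.2.2.1, p.2.2.2))

def rhoB : Matrix B B ℂ :=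
  redDM fun p : B × (A × C × D) => ψ ((p.2.1, p.1), (p.2.2.1, p.2.2.2))

def rhoC : Matrix C C ℂ :=
  redDM fun p : C × (A × B × D) => ψ ((p.2.1, p.2.2.1), (p.1, p.2.2.2))

def rhoD : Matrix D D ℂ :=
  redDM fun p : D × (A × B × C) => ψ ((p.2.1, p.2.2.1), (p.2.2.2, p.1))

def rhoAB : Matrix (A × B) (A × B) ℂ := redDM ψ

def rhoAC : Matrix (A × C) (A × C) ℂ :=
  redDM fun p : (A × C) × B × D => ψ ((p.1.1, p.2.1), (p.1.2, p.2.2))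

def rhoAD : Matrix (A × D) (A × D) ℂ :=
  redDM fun p : (A × D) × B × C => ψ ((p.1.1, p.2.1), (p.2.2, p.1.2))

def rhoBC : Matrix (B × C) (B × C) ℂ :=
  redDM fun p : (B × C) × A × D => ψ ((p.2.1, p.1.1), (p.1.2, p.2.2))

def rhoBD : Matrix (B × D) (B × D) ℂ :=
  redDM fun p : (B × D) × A × C => ψ ((p.2.1, p.1.1), (p.2.2, p.1.2))

def rhoCD : Matrix (C × D) (C × D) ℂ :=
  redDM fun p : (C × D) × A × B => ψ (p.2, p.1)

def rhoABC : Matrix ((A × B) × C) ((A × B) × C) ℂ :=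
  redDM fun p : ((A × B) × C) × D => ψ (p.1.1, (p.1.2, p.2))

def rhoABD : Matrix ((A × B) × D) ((A × B) × D) ℂ :=
  redDM fun p : ((A × B) × D) × C => ψ (p.1.1, (p.2, p.1.2))

def rhoACD : Matrix (A × C × D) (A × C × D) ℂ :=
  redDM fun p : (A × C × D) × B => ψ ((p.1.1, p.2), p.1.2)

def rhoBCD : Matrix (B × C × D) (B × C × D) ℂ :=
  redDM fun p : (B × C × D) × A => ψ ((p.2, p.1.1), p.1.2)

/-- Subsystem von Neumann entropies. -/
def SA : ℝ := vNE (rhoA ψ)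
def SB : ℝ := vNE (rhoB ψ)
def SC : ℝ := vNE (rhoC ψ)
def SD : ℝ := vNE (rhoD ψ)
def SAB : ℝ := vNE (rhoAB ψ)
def SAC : ℝ := vNE (rhoAC ψ)
def SAD : ℝ := vNE (rhoAD ψ)
def SBC : ℝ := vNE (rhoBC ψ)
def SBD : ℝ := vNE (rhoBD ψ)
def SCD : ℝ := vNE (rhoCD ψ)
def SABC : ℝ := vNE (rhoABC ψ)
def SABD : ℝ := vNE (rhoABD ψ)
def SACD : ℝ := vNE (rhoACD ψ)
def SBCD : ℝ := vNE (rhoBCD ψ)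

/-- Mutual informations `I(X;Y) = S(X) + S(Y) - S(XY)`. -/
def IAB : ℝ := SA ψ + SB ψ - SAB ψ
def IAC : ℝ := SA ψ + SC ψ - SAC ψ
def IAD : ℝ := SA ψ + SD ψ - SAD ψ
def IBC : ℝ := SB ψ + SC ψ - SBC ψ
def IBD : ℝ := SB ψ + SD ψ - SBD ψ
def ICD : ℝ := SC ψ + SD ψ - SCD ψ
def IACD : ℝ := SA ψ + SCD ψ - SACD ψ

/-- Tripartite information `I₃(A;C;D) = I(A;C) + I(A;D) - I(A;CD)`. -/
def I3ACD : ℝ := IAC ψ + IAD ψ - IACD ψ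

/-- Conditional mutual informations. -/
def cmiAB_C : ℝ := SAC ψ + SBC ψ - SC ψ - SABC ψ
def cmiAB_D : ℝ := SAD ψ + SBD ψ - SD ψ - SABD ψ
def cmiCD_A : ℝ := SAC ψ + SAD ψ - SA ψ - SACD ψ
def cmiCD_B : ℝ := SBC ψ + SBD ψ - SB ψ - SBCD ψ

/-- Rényi-2 entropy `S₂(ρ) = -log₂ tr ρ²`. -/
def S2 {n : Type*} [Fintype n] (ρ : Matrix n n ℂ) : ℝ :=
  -Real.logb 2 ((ρ * ρ).trace.re)

/-- Rényi-2 tripartite information `I₃⁽²⁾ = S₂(A) + S₂(B) - S₂(AC) - S₂(AD)`. -/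
def I3r2 : ℝ := S2 (rhoA ψ) + S2 (rhoB ψ) - S2 (rhoAC ψ) - S2 (rhoAD ψ)

end FourParty

/-- The residual channel `N_{A→C}(σ) = tr_D [U (σ ⊗ τ_B) Uᴴ]`. -/
def residual {A B C D : Type*} [Fintype A] [Fintype B] [Fintype C] [Fintype D]
    [DecidableEq A] [DecidableEq B]
    (U : Matrix (C × D) (A × B) ℂ) (σ : Matrix A A ℂ) : Matrix C C ℂ :=
  Matrix.of fun c c' => ∑ d, (U * (σ ⊗ₖ mmState B) * Uᴴ) (c, d) (c', d)

/-- A unitary on `X ⊗ X` is a perfect tensor iff all two-party marginals of its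
Choi state are maximally mixed. -/
def PerfectTensor {X : Type*} [Fintype X] [DecidableEq X]
    (U : Matrix (X × X) (X × X) ℂ) : Prop :=
  rhoAB (choiVec U) = mmState (X × X) ∧ rhoAC (choiVec U) = mmState (X × X) ∧
  rhoAD (choiVec U) = mmState (X × X) ∧ rhoBC (choiVec U) = mmState (X × X) ∧
  rhoBD (choiVec U) = mmState (X × X) ∧ rhoCD (choiVec U) = mmState (X × X)

/-- The unitary `U_d` which acts as `U_S` on the subspace spanned by the first `d_S`
basis vectors of each tensor factor, and as the identity otherwise. -/
def embedU (dS d : ℕ) (h : dS ≤ d) (US : Matrix (Fin dS × Fin dS) (Fin dS × Fin dS) ℂ) :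
    Matrix (Fin d × Fin d) (Fin d × Fin d) ℂ :=
  Matrix.of fun o i =>
    if hi : i.1.val < dS ∧ i.2.val < dS then
      if ho : o.1.val < dS ∧ o.2.val < dS then
        US (⟨o.1.val, ho.1⟩, ⟨o.2.val, ho.2⟩) (⟨i.1.val, hi.1⟩, ⟨i.2.val, hi.2⟩)
      else 0
    else if o = i then 1 else 0



lemma traceNorm_of_diag {n : Type*} [Fintype n] [DecidableEq n] (X V W : Matrix n n ℂ)
    (lam : n → ℝ) (hWV : W * V = 1) (hX : X = V * diagonal (fun i => (lam i : ℂ)) * W)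
    (hH : X.IsHermitian) : traceNorm X = ∑ i, |lam i| := by
  have h1 : (Xᴴ * X).charpoly = (diagonal (fun i => ((lam i ^ 2 : ℝ) : ℂ))).charpoly := by
    rw [hH.eq]
    have : X * X = V * diagonal (fun i => ((lam i ^ 2 : ℝ) : ℂ)) * W := by
      rw [hX]
      calc _ = V * diagonal (fun i => (lam i : ℂ)) * (W * V) *
                diagonal (fun i => (lam i : ℂ)) * W := by simp only [Matrix.mul_assoc]
        _ = _ := by
          rw [hWV, Matrix.mul_one, Matrix.mul_assoc V, diagonal_mul_diagonal]
          congr 3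
          ext i; push_cast; ring
    rw [this, Matrix.charpoly_mul_comm, ← Matrix.mul_assoc, hWV, Matrix.one_mul]
  have h2 := (Matrix.posSemidef_conjTranspose_mul_self X).1.roots_charpoly_eq_eigenvalues
  rw [h1, charpoly_diagonal, Polynomial.roots_prod _ _
    (Finset.prod_ne_zero_iff.2 fun i _ => Polynomial.X_sub_C_ne_zero _)] at h2
  simp only [Polynomial.roots_X_sub_C, Multiset.bind_singleton] at h2
  have h3 := congrArg (fun s => (s.map (fun z : ℂ => Real.sqrt z.re)).sum) h2
  simp only [Multiset.map_map, Function.comp_def, Complex.ofReal_re, RCLike.ofReal_eq_complex_ofReal] at h3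
  unfold traceNorm
  have h4 : ∀ i, |lam i| = Real.sqrt (lam i ^ 2) := fun i => (Real.sqrt_sq_eq_abs _).symm
  simp only [h4]
  exact h3.symm

lemma traceNorm_sub_le {n : Type*} [Fintype n] [DecidableEq n] (P Q : Matrix n n ℂ)
    (hP : P.PosSemidef) (hQ : Q.PosSemidef) :
    traceNorm (P - Q) ≤ P.trace.re + Q.trace.re := by
  have hH : (P - Q).IsHermitian := hP.1.sub hQ.1
  set V : Matrix n n ℂ := hH.eigenvectorUnitary.1 with hV
  have hVV : Vᴴ * V = 1 := by
    have := Unitary.star_mul_self_of_mem hH.eigenvectorUnitary.2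
    exact this
  have hVV' : V * Vᴴ = 1 := by
    have := Unitary.mul_star_self_of_mem hH.eigenvectorUnitary.2
    exact this
  have hsp : P - Q = V * diagonal (fun i => (hH.eigenvalues i : ℂ)) * Vᴴ := by
    have := hH.spectral_theorem
    rw [Unitary.conjStarAlgAut_apply] at this
    exact this
  rw [traceNorm_of_diag _ V Vᴴ _ hVV hsp hH]
  have hd : diagonal (fun i => (hH.eigenvalues i : ℂ)) = Vᴴ * P * V - Vᴴ * Q * V := by
    rw [← Matrix.sub_mul, ← Matrix.mul_sub]
    conv_rhs => rw [hsp]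
    calc _ = (Vᴴ * V) * diagonal (fun i => (hH.eigenvalues i : ℂ)) * (Vᴴ * V) := by
            rw [hVV]; simp
      _ = _ := by simp only [Matrix.mul_assoc]
  have hP' : (Vᴴ * P * V).PosSemidef := hP.conjTranspose_mul_mul_same V
  have hQ' : (Vᴴ * Q * V).PosSemidef := hQ.conjTranspose_mul_mul_same V
  have tP : P.trace = (Vᴴ * P * V).trace := by
    rw [Matrix.trace_mul_comm, ← Matrix.mul_assoc, hVV', Matrix.one_mul]
  have tQ : Q.trace = (Vᴴ * Q * V).trace := by
    rw [Matrix.trace_mul_comm, ← Matrix.mul_assoc, hVV', Matrix.one_mul]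
  rw [tP, tQ]
  simp only [Matrix.trace, Matrix.diag_apply, Complex.re_sum]
  rw [← Finset.sum_add_distrib]
  apply Finset.sum_le_sum
  intro i _
  have e := congrArg (fun M => (M i i).re) hd
  simp only [diagonal_apply_eq, Matrix.sub_apply, Complex.sub_re, Complex.ofReal_re] at e
  have p0 := (Complex.le_def.1 (hP'.diag_nonneg (i := i))).1
  have q0 := (Complex.le_def.1 (hQ'.diag_nonneg (i := i))).1
  simp only [Complex.zero_re] at p0 q0
  rw [e, abs_le]
  constructor <;> linarith

/-- Kraus operators of the extended residual channel. -/
def krausR (R : Type*) {A B C D : Type*} [DecidableEq R]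
    (U : Matrix (C × D) (A × B) ℂ) (p : D × B) : Matrix (R × C) (R × A) ℂ :=
  Matrix.of fun x y => if x.1 = y.1 then U (x.2, p.1) (y.2, p.2) else 0

lemma extend_residual {R A B C D : Type*} [Fintype R] [DecidableEq R]
    [Fintype A] [Fintype B] [Fintype C] [Fintype D]
    [DecidableEq A] [DecidableEq B]
    (U : Matrix (C × D) (A × B) ℂ) (ρ : Matrix (R × A) (R × A) ℂ) :
    extendCh (residual U) ρ =
      (Fintype.card B : ℂ)⁻¹ • ∑ p : D × B, krausR R U p * ρ * (krausR R U p)ᴴ := by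
  ext ⟨r, c⟩ ⟨r', c'⟩
  simp only [extendCh, residual, mmState, krausR, Matrix.of_apply, Matrix.smul_apply,
    Matrix.sum_apply, Matrix.mul_apply, Fintype.sum_prod_type, kroneckerMap_apply,
    Matrix.one_apply, conjTranspose_apply, smul_eq_mul, Finset.mul_sum, Finset.sum_mul]
  simp only [mul_ite, ite_mul, mul_one, mul_zero, zero_mul, star_zero, apply_ite star,
    Finset.sum_ite_eq, Finset.sum_ite_eq', Finset.mem_univ, if_true]
  simp only [Finset.sum_ite_irrel, Finset.sum_const_zero,
    Finset.sum_ite_eq, Finset.sum_ite_eq', Finset.mem_univ, if_true]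
  refine Finset.sum_congr rfl fun e _ => ?_
  rw [Finset.sum_comm]
  refine Finset.sum_congr rfl fun b _ => ?_
  refine Finset.sum_congr rfl fun a _ => ?_
  refine Finset.sum_congr rfl fun a' _ => ?_
  ring

lemma extend_posSemidef {R A B C D : Type*} [Fintype R] [DecidableEq R]
    [Fintype A] [Fintype B] [Fintype C] [Fintype D]
    [DecidableEq A] [DecidableEq B]
    (U : Matrix (C × D) (A × B) ℂ) (ρ : Matrix (R × A) (R × A) ℂ) (hρ : ρ.PosSemidef) :
    (extendCh (residual U) ρ).PosSemidef := by
  rw [extend_residual]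
  refine Matrix.PosSemidef.smul ?_ (by simp)
  exact Matrix.posSemidef_sum _ fun p _ => hρ.mul_mul_conjTranspose_same _

lemma extend_trace {R A B C D : Type*} [Fintype R] [DecidableEq R]
    [Fintype A] [Fintype B] [Fintype C] [Fintype D] [Nonempty B]
    [DecidableEq A] [DecidableEq B]
    (U : Matrix (C × D) (A × B) ℂ) (ρ : Matrix (R × A) (R × A) ℂ)
    (hU : ∀ a a', ∑ e, ∑ b, ∑ c, U (c, e) (a, b) * star (U (c, e) (a', b)) =
      if a = a' then (Fintype.card B : ℂ) else 0) :
    (extendCh (residual U) ρ).trace = ρ.trace := by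
  have hK : ∑ p : D × B, (krausR R U p)ᴴ * krausR R U p = (Fintype.card B : ℂ) • 1 := by
    ext ⟨r, a⟩ ⟨r', a'⟩
    simp only [krausR, Matrix.smul_apply,
      Matrix.sum_apply, Matrix.mul_apply, Fintype.sum_prod_type,
      Matrix.one_apply, conjTranspose_apply, smul_eq_mul, Matrix.of_apply, apply_ite star, star_zero,
      mul_ite, ite_mul, zero_mul, mul_zero, Prod.mk.injEq]
    simp only [Finset.sum_ite_irrel, Finset.sum_const_zero,
      Finset.sum_ite_eq, Finset.sum_ite_eq', Finset.mem_univ, if_true]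
    by_cases hr : r' = r
    · subst hr
      have := hU a' a
      simp only [mul_comm (star _)]
      simp only [if_true, this, true_and]
      by_cases h : a = a'
      · simp [h]
      · simp [h, Ne.symm h]
    · simp [hr, Ne.symm hr]
  rw [extend_residual, Matrix.trace_smul, Matrix.trace_sum]
  have : ∀ p : D × B, (krausR R U p * ρ * (krausR R U p)ᴴ).trace =
      ((krausR R U p)ᴴ * krausR R U p * ρ).trace := fun p => by
    rw [Matrix.trace_mul_comm, Matrix.mul_assoc]
  simp only [this]
  rw [← Matrix.trace_sum, ← Matrix.sum_mul, hK]
  simp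

/-- The swap unitary. -/
def swapM (d : ℕ) : Matrix (Fin d × Fin d) (Fin d × Fin d) ℂ :=
  Matrix.of fun o i => if o.1 = i.2 ∧ o.2 = i.1 then 1 else 0

lemma residual_swap (d : ℕ) : residual (swapM d) = depol (Fin d) (Fin d) := by
  ext σ c c'
  simp only [residual, depol, swapM, mmState, Matrix.of_apply, Matrix.smul_apply,
    Matrix.mul_apply, Fintype.sum_prod_type, kroneckerMap_apply, ite_and,
    Matrix.one_apply, conjTranspose_apply, smul_eq_mul, Matrix.trace, Matrix.diag_apply,
    mul_ite, ite_mul, mul_one, mul_zero, zero_mul, one_mul, apply_ite star, star_zero, star_one]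
  simp [Finset.sum_ite_irrel, ← Finset.sum_mul]

lemma swap_cond (d : ℕ) (a a' : Fin d) :
    ∑ e, ∑ b, ∑ c, swapM d (c, e) (a, b) * star (swapM d (c, e) (a', b)) =
      if a = a' then (Fintype.card (Fin d) : ℂ) else 0 := by
  simp only [swapM, Matrix.of_apply, ite_and, mul_ite, ite_mul, mul_one, mul_zero, zero_mul,
    one_mul, apply_ite star, star_zero, star_one]
  by_cases h : a = a'
  · subst h; simp [Finset.sum_ite_irrel]
  · simp [Finset.sum_ite_irrel, h, Ne.symm h]

lemma bddAbove_residual (d : ℕ) (hd : 0 < d) (U : Matrix (Fin d × Fin d) (Fin d × Fin d) ℂ)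
    (hU : ∀ a a', ∑ e, ∑ b, ∑ c, U (c, e) (a, b) * star (U (c, e) (a', b)) =
      if a = a' then (Fintype.card (Fin d) : ℂ) else 0) :
    BddAbove {x | ∃ (n : ℕ) (ρ : Matrix (Fin n × Fin d) (Fin n × Fin d) ℂ),
    IsDensityMatrix ρ ∧ x = traceNorm (extendCh (residual U) ρ -
      extendCh (depol (Fin d) (Fin d)) ρ)} := by
  haveI : Nonempty (Fin d) := ⟨⟨0, hd⟩⟩
  refine ⟨2, ?_⟩
  rintro x ⟨n, ρ, hρ, rfl⟩
  rw [← residual_swap]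
  refine (traceNorm_sub_le _ _ (extend_posSemidef _ _ hρ.1) (extend_posSemidef _ _ hρ.1)).trans ?_
  rw [extend_trace _ _ hU, extend_trace _ _ (swap_cond d), hρ.2]
  norm_num

/-- Zero extension of `US`. -/
def extU (dS d : ℕ) (US : Matrix (Fin dS × Fin dS) (Fin dS × Fin dS) ℂ)
    (c e a b : Fin d) : ℂ :=
  if hh : (c.val < dS ∧ e.val < dS) ∧ (a.val < dS ∧ b.val < dS) then
    US (⟨c.val, hh.1.1⟩, ⟨e.val, hh.1.2⟩) (⟨a.val, hh.2.1⟩, ⟨b.val, hh.2.2⟩) else 0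

lemma extU_castLE (dS d : ℕ) (h : dS ≤ d) (US : Matrix (Fin dS × Fin dS) (Fin dS × Fin dS) ℂ)
    (c e a b : Fin dS) :
    extU dS d US (Fin.castLE h c) (Fin.castLE h e) (Fin.castLE h a) (Fin.castLE h b) =
      US (c, e) (a, b) := by
  simp [extU]

lemma extU_zero (dS d : ℕ) (US : Matrix (Fin dS × Fin dS) (Fin dS × Fin dS) ℂ)
    (c e a b : Fin d) (hn : ¬ ((c.val < dS ∧ e.val < dS) ∧ (a.val < dS ∧ b.val < dS))) :
    extU dS d US c e a b = 0 := by
  rw [extU, dif_neg hn]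

lemma embedU_eq (dS d : ℕ) (h : dS ≤ d) (US : Matrix (Fin dS × Fin dS) (Fin dS × Fin dS) ℂ)
    (c e a b : Fin d) :
    embedU dS d h US (c, e) (a, b) = extU dS d US c e a b +
      if (¬ (a.val < dS ∧ b.val < dS)) ∧ c = a ∧ e = b then 1 else 0 := by
  by_cases h1 : a.val < dS ∧ b.val < dS
  · by_cases h2 : c.val < dS ∧ e.val < dS
    · simp [embedU, extU, h1, h2]
    · simp [embedU, extU, h1, h2]
  · simp [embedU, extU, h1]

lemma sum_castLE (dS d : ℕ) (h : dS ≤ d) (f : Fin d → ℂ) (hf : ∀ x, ¬ x.val < dS → f x = 0) :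
    ∑ x, f x = ∑ y : Fin dS, f (Fin.castLE h y) := by
  obtain ⟨k, rfl⟩ := Nat.exists_eq_add_of_le h
  rw [Fin.sum_univ_add]
  have : ∑ i : Fin k, f (Fin.natAdd dS i) = 0 :=
    Finset.sum_eq_zero fun i _ => hf _ (by simp)
  rw [this, add_zero]
  rfl

lemma exists_castLE {dS d : ℕ} (h : dS ≤ d) (x : Fin d) (hx : x.val < dS) :
    ∃ y : Fin dS, Fin.castLE h y = x := ⟨⟨x.val, hx⟩, rfl⟩

lemma sqrt_factor (n : ℕ) (x y : ℂ) :
    ((Real.sqrt (n * n) : ℂ)⁻¹ * x) * star ((Real.sqrt (n * n) : ℂ)⁻¹ * y) =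
      ((n : ℂ) * n)⁻¹ * (x * star y) := by
  rw [Real.sqrt_mul_self (Nat.cast_nonneg n)]
  simp
  ring

lemma rhoAC_apply (n : ℕ) (U : Matrix (Fin n × Fin n) (Fin n × Fin n) ℂ) (a c a' c' : Fin n) :
    rhoAC (choiVec U) (a, c) (a', c') =
      ((n : ℂ) * n)⁻¹ * ∑ b, ∑ e, U (c, e) (a, b) * star (U (c', e) (a', b)) := by
  simp only [rhoAC, redDM, choiVec, Matrix.of_apply, Fintype.sum_prod_type, Fintype.card_fin,
    sqrt_factor, Finset.mul_sum]

lemma rhoAD_apply (n : ℕ) (U : Matrix (Fin n × Fin n) (Fin n × Fin n) ℂ) (a e a' e' : Fin n) :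
    rhoAD (choiVec U) (a, e) (a', e') =
      ((n : ℂ) * n)⁻¹ * ∑ b, ∑ c, U (c, e) (a, b) * star (U (c, e') (a', b)) := by
  simp only [rhoAD, redDM, choiVec, Matrix.of_apply, Fintype.sum_prod_type, Fintype.card_fin,
    sqrt_factor, Finset.mul_sum]

lemma rhoBD_apply (n : ℕ) (U : Matrix (Fin n × Fin n) (Fin n × Fin n) ℂ) (b e b' e' : Fin n) :
    rhoBD (choiVec U) (b, e) (b', e') =
      ((n : ℂ) * n)⁻¹ * ∑ a, ∑ c, U (c, e) (a, b) * star (U (c, e') (a, b')) := by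
  simp only [rhoBD, redDM, choiVec, Matrix.of_apply, Fintype.sum_prod_type, Fintype.card_fin,
    sqrt_factor, Finset.mul_sum]

lemma mm_apply (n : ℕ) (x y : Fin n × Fin n) :
    mmState (Fin n × Fin n) x y = ((n : ℂ) * n)⁻¹ * if x = y then 1 else 0 := by
  simp [mmState, Matrix.one_apply]

lemma inv_cancel (n : ℕ) (hn : 0 < n) {x y : ℂ} (hxy : ((n : ℂ) * n)⁻¹ * x = ((n : ℂ) * n)⁻¹ * y) :
    x = y := by
  have : ((n : ℂ) * n)⁻¹ ≠ 0 := by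
    have : (n : ℂ) ≠ 0 := by exact_mod_cast hn.ne'
    simp [this]
  exact mul_left_cancel₀ this hxy


lemma ext_AC (dS d : ℕ) (h : dS ≤ d) (hpos : 0 < dS)
    (US : Matrix (Fin dS × Fin dS) (Fin dS × Fin dS) ℂ) (hUSp : PerfectTensor US) (a c a' c' : Fin d) :
    ∑ b, ∑ e, extU dS d US c e a b * star (extU dS d US c' e a' b) =
      if (a.val < dS ∧ c.val < dS) ∧ a = a' ∧ c = c' then 1 else 0 := by
  by_cases hh : (a.val < dS ∧ c.val < dS) ∧ (a'.val < dS ∧ c'.val < dS)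
  · obtain ⟨⟨ha, hc⟩, ha', hc'⟩ := hh
    obtain ⟨a, rfl⟩ := exists_castLE h a ha
    obtain ⟨a', rfl⟩ := exists_castLE h a' ha'
    obtain ⟨c, rfl⟩ := exists_castLE h c hc
    obtain ⟨c', rfl⟩ := exists_castLE h c' hc'
    rw [sum_castLE dS d h _ (fun b hb => Finset.sum_eq_zero fun e _ => by
      rw [extU_zero _ _ _ _ _ _ _ (by tauto), zero_mul])]
    have key := congrFun (congrFun hUSp.2.1 (a, c)) (a', c')
    rw [rhoAC_apply, mm_apply] at key
    have key := inv_cancel dS hpos key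
    convert key using 1
    · refine Finset.sum_congr rfl fun b _ => ?_
      rw [sum_castLE dS d h _ (fun e he => by
        rw [extU_zero _ _ _ _ _ _ _ (by tauto), zero_mul])]
      simp only [extU_castLE]
    · simp
  · rw [if_neg (by rintro ⟨h1, rfl, rfl⟩; tauto)]
    refine Finset.sum_eq_zero fun b _ => Finset.sum_eq_zero fun e _ => ?_
    by_cases h1 : (a.val < dS ∧ c.val < dS)
    · rw [extU_zero _ _ _ c' _ _ _ (by tauto), star_zero, mul_zero]
    · rw [extU_zero _ _ _ _ _ _ _ (by tauto), zero_mul]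

lemma ext_AD (dS d : ℕ) (h : dS ≤ d) (hpos : 0 < dS)
    (US : Matrix (Fin dS × Fin dS) (Fin dS × Fin dS) ℂ) (hUSp : PerfectTensor US) (a e a' e' : Fin d) :
    ∑ b, ∑ c, extU dS d US c e a b * star (extU dS d US c e' a' b) =
      if (a.val < dS ∧ e.val < dS) ∧ a = a' ∧ e = e' then 1 else 0 := by
  by_cases hh : (a.val < dS ∧ e.val < dS) ∧ (a'.val < dS ∧ e'.val < dS)
  · obtain ⟨⟨ha, hc⟩, ha', hc'⟩ := hh
    obtain ⟨a, rfl⟩ := exists_castLE h a ha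
    obtain ⟨a', rfl⟩ := exists_castLE h a' ha'
    obtain ⟨e, rfl⟩ := exists_castLE h e hc
    obtain ⟨e', rfl⟩ := exists_castLE h e' hc'
    rw [sum_castLE dS d h _ (fun b hb => Finset.sum_eq_zero fun c _ => by
      rw [extU_zero _ _ _ _ _ _ _ (by tauto), zero_mul])]
    have key := congrFun (congrFun hUSp.2.2.1 (a, e)) (a', e')
    rw [rhoAD_apply, mm_apply] at key
    have key := inv_cancel dS hpos key
    convert key using 1
    · refine Finset.sum_congr rfl fun b _ => ?_
      rw [sum_castLE dS d h _ (fun c hc => by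
        rw [extU_zero _ _ _ _ _ _ _ (by tauto), zero_mul])]
      simp only [extU_castLE]
    · simp
  · rw [if_neg (by rintro ⟨h1, rfl, rfl⟩; tauto)]
    refine Finset.sum_eq_zero fun b _ => Finset.sum_eq_zero fun c _ => ?_
    by_cases h1 : (a.val < dS ∧ e.val < dS)
    · rw [extU_zero _ _ _ _ e' _ _ (by tauto), star_zero, mul_zero]
    · rw [extU_zero _ _ _ _ _ _ _ (by tauto), zero_mul]

lemma ext_BD (dS d : ℕ) (h : dS ≤ d) (hpos : 0 < dS)
    (US : Matrix (Fin dS × Fin dS) (Fin dS × Fin dS) ℂ) (hUSp : PerfectTensor US) (b : Fin d) :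
    ∑ a, ∑ c, extU dS d US c b a b * star (extU dS d US c b a b) =
      if b.val < dS then 1 else 0 := by
  by_cases hb : b.val < dS
  · obtain ⟨b, rfl⟩ := exists_castLE h b hb
    rw [sum_castLE dS d h _ (fun a ha => Finset.sum_eq_zero fun c _ => by
      rw [extU_zero _ _ _ _ _ _ _ (by tauto), zero_mul])]
    have key := congrFun (congrFun hUSp.2.2.2.2.1 (b, b)) (b, b)
    rw [rhoBD_apply, mm_apply] at key
    have key := inv_cancel dS hpos key
    convert key using 1
    · refine Finset.sum_congr rfl fun a _ => ?_
      rw [sum_castLE dS d h _ (fun c hc => by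
        rw [extU_zero _ _ _ _ _ _ _ (by tauto), zero_mul])]
      simp only [extU_castLE]
    · simp
  · rw [if_neg hb]
    refine Finset.sum_eq_zero fun a _ => Finset.sum_eq_zero fun c _ => ?_
    rw [extU_zero _ _ _ _ _ _ _ (by tauto), zero_mul]

lemma embed_AD (dS d : ℕ) (h : dS ≤ d) (hpos : 0 < dS)
    (US : Matrix (Fin dS × Fin dS) (Fin dS × Fin dS) ℂ) (hUSp : PerfectTensor US) (a e a' e' : Fin d) :
    ∑ b, ∑ c, embedU dS d h US (c, e) (a, b) * star (embedU dS d h US (c, e') (a', b)) =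
      if a = a' ∧ e = e' then 1 else 0 := by
  have hterm : ∀ b c, embedU dS d h US (c, e) (a, b) * star (embedU dS d h US (c, e') (a', b)) =
      extU dS d US c e a b * star (extU dS d US c e' a' b) +
      (if e = b then (if a = c then
        (if (¬ (a.val < dS ∧ e.val < dS)) ∧ a = a' ∧ e = e' then 1 else 0) else 0) else 0) := by
    intro b c
    rw [embedU_eq, embedU_eq, star_add, apply_ite star, star_one, star_zero, add_mul, mul_add, mul_add]
    have x1 : extU dS d US c e a b *
        (if (¬ (a'.val < dS ∧ b.val < dS)) ∧ c = a' ∧ e' = b then 1 else 0) = 0 := by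
      split_ifs with hc
      · rw [extU_zero _ _ _ _ _ _ _ (by rintro h1; obtain ⟨h2, rfl, rfl⟩ := hc; tauto), zero_mul]
      · simp
    have x2 : (if (¬ (a.val < dS ∧ b.val < dS)) ∧ c = a ∧ e = b then 1 else 0) *
        star (extU dS d US c e' a' b) = 0 := by
      split_ifs with hc
      · rw [extU_zero _ _ _ _ _ _ _ (by rintro h1; obtain ⟨h2, rfl, rfl⟩ := hc; tauto), star_zero,
          mul_zero]
      · simp
    rw [x1, x2, add_zero, zero_add]
    congr 1
    by_cases h1 : e = b
    · subst h1
      by_cases h2 : a = c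
      · subst h2
        by_cases h3 : a = a'
        · subst h3
          by_cases h4 : e = e'
          · subst h4; simp
          · simp [h4, Ne.symm h4]
        · simp [h3]
      · simp [h2, Ne.symm h2]
    · simp [h1]
  simp only [hterm, Finset.sum_add_distrib]
  rw [ext_AD dS d h hpos US hUSp]
  simp [Finset.sum_ite_irrel]
  by_cases h3 : a = a' ∧ e = e'
  · obtain ⟨rfl, rfl⟩ := h3
    by_cases h4 : a.val < dS ∧ e.val < dS
    · simp [h4]
    · simp only [and_true, h4, if_false]
      simp
      intro h5; exact not_lt.1 fun h6 => h4 ⟨h5, h6⟩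
  · simp [h3]

lemma embed_cond (dS d : ℕ) (h : dS ≤ d) (hpos : 0 < dS)
    (US : Matrix (Fin dS × Fin dS) (Fin dS × Fin dS) ℂ) (hUSp : PerfectTensor US) (a a' : Fin d) :
    ∑ e, ∑ b, ∑ c, embedU dS d h US (c, e) (a, b) * star (embedU dS d h US (c, e) (a', b)) =
      if a = a' then (Fintype.card (Fin d) : ℂ) else 0 := by
  simp only [embed_AD dS d h hpos US hUSp]
  by_cases h1 : a = a' <;> simp [h1]

lemma part1 (dS d : ℕ) (h : dS ≤ d) (hpos : 0 < dS)
    (US : Matrix (Fin dS × Fin dS) (Fin dS × Fin dS) ℂ) (hUSp : PerfectTensor US) : rhoAD (choiVec (embedU dS d h US)) = mmState (Fin d × Fin d) := by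
  ext ⟨a, e⟩ ⟨a', e'⟩
  rw [rhoAD_apply, mm_apply, embed_AD dS d h hpos US hUSp]
  simp

lemma part3 (dS d : ℕ) (h : dS ≤ d) (hpos : 0 < dS)
    (US : Matrix (Fin dS × Fin dS) (Fin dS × Fin dS) ℂ) (hUSp : PerfectTensor US) (hlt : dS < d) : 2 - 2 / (d : ℝ) ≤
    diamondDist (residual (embedU dS d h US)) (depol (Fin d) (Fin d)) := by
  have hd : 0 < d := by omega
  have hbdd := bddAbove_residual d hd _ (embed_cond dS d h hpos US hUSp)
  let s : Fin d := ⟨dS, hlt⟩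
  let ρ : Matrix (Fin 1 × Fin d) (Fin 1 × Fin d) ℂ :=
    diagonal fun x => if x.2 = s then 1 else 0
  have hρ : IsDensityMatrix ρ := by
    constructor
    · refine Matrix.PosSemidef.diagonal fun x => ?_
      show (0 : ℂ) ≤ if x.2 = s then 1 else 0
      split_ifs <;> simp
    · simp only [ρ, Matrix.trace, Matrix.diag_apply, diagonal_apply_eq, Fintype.sum_prod_type]
      simp
  have hX : extendCh (residual (embedU dS d h US)) ρ - extendCh (depol (Fin d) (Fin d)) ρ =
      1 * diagonal (fun x : Fin 1 × Fin d =>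
        ((((if x.2 = s then 1 else 0) - (d : ℝ)⁻¹ : ℝ)) : ℂ)) * 1 := by
    rw [Matrix.one_mul, Matrix.mul_one]
    ext ⟨r, c⟩ ⟨r', c'⟩
    obtain rfl : r = 0 := Subsingleton.elim _ _
    obtain rfl : r' = 0 := Subsingleton.elim _ _
    have hE : ∀ c e b, embedU dS d h US (c, e) (s, b) = if c = s ∧ e = b then 1 else 0 := by
      intro c e b
      rw [embedU_eq, extU_zero _ _ _ _ _ _ _ (by simp [s])]
      simp [s]
    have h1 : extendCh (residual (embedU dS d h US)) ρ (0, c) (0, c') =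
        if c = s ∧ c' = s then 1 else 0 := by
      have hdc : (d : ℂ) ≠ 0 := by exact_mod_cast hd.ne'
      have hρ0 : ∀ x y, ρ (0, x) (0, y) = if x = s then (if y = s then 1 else 0) else 0 := by
        intro x y
        by_cases hx : x = s
        · by_cases hy : y = s
          · simp [ρ, hx, hy]
          · simp [ρ, hx, hy, Ne.symm hy, diagonal_apply]
        · simp [ρ, hx, diagonal_apply]
      simp only [extendCh, residual, mmState, Matrix.of_apply, Matrix.smul_apply,
        Matrix.mul_apply, Fintype.sum_prod_type, kroneckerMap_apply,
        Matrix.one_apply, conjTranspose_apply, smul_eq_mul, hρ0,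
        mul_ite, ite_mul, mul_one, mul_zero, zero_mul, one_mul]
      simp [Finset.sum_ite_irrel, hE]
      by_cases hc : c = s <;> by_cases hc' : c' = s <;> simp [hc, hc', hdc]
    have h2 : extendCh (depol (Fin d) (Fin d)) ρ (0, c) (0, c') =
        if c = c' then (d : ℂ)⁻¹ else 0 := by
      simp [extendCh, depol, mmState, ρ, Matrix.trace, Matrix.one_apply]
    rw [Matrix.sub_apply, h1, h2]
    by_cases hc : c = c'
    · subst hc
      by_cases hc' : c = s <;> simp [hc']
    · have : ¬ (c = s ∧ c' = s) := by rintro ⟨rfl, h⟩; exact hc h.symm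
      simp [hc, diagonal_apply, this]
  have hH : (extendCh (residual (embedU dS d h US)) ρ -
      extendCh (depol (Fin d) (Fin d)) ρ).IsHermitian := by
    rw [hX, Matrix.one_mul, Matrix.mul_one]
    refine Matrix.isHermitian_diagonal_of_self_adjoint _ ?_
    ext x
    simp only [Pi.star_apply, RCLike.star_def, Complex.conj_ofReal]
  have hT := traceNorm_of_diag _ _ _ _ (Matrix.one_mul 1) hX hH
  refine le_csSup_of_le hbdd ⟨1, ρ, hρ, rfl⟩ ?_
  rw [hT, Fintype.sum_prod_type]
  have hdr : (1 : ℝ) ≤ d := by exact_mod_cast hd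
  have hi : (d : ℝ)⁻¹ ≤ 1 := inv_le_one_of_one_le₀ hdr
  have hi0 : 0 ≤ (d : ℝ)⁻¹ := by positivity
  have : ∀ x : Fin d, |(if x = s then 1 else 0) - (d : ℝ)⁻¹| =
      (d : ℝ)⁻¹ + if x = s then 1 - 2 * (d : ℝ)⁻¹ else 0 := by
    intro x
    split_ifs
    · rw [abs_of_nonneg (by linarith)]; ring
    · rw [zero_sub, abs_neg, abs_of_nonneg hi0, add_zero]
  simp only [this, Finset.sum_add_distrib]
  have hdne : (d : ℝ) ≠ 0 := by positivity
  simp [hdne]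
  rw [div_eq_mul_inv]
  linarith

lemma part2 (dS d : ℕ) (h : dS ≤ d) (hpos : 0 < dS)
    (US : Matrix (Fin dS × Fin dS) (Fin dS × Fin dS) ℂ) (hUSp : PerfectTensor US)
    (hlt : dS < d) :
    traceNorm (rhoAC (choiVec (embedU dS d h US)) - mmState (Fin d × Fin d)) ≤
      8 * ((d - dS : ℕ) : ℝ) / d := by
  have hd : 0 < d := by omega
  have hdc : (d : ℂ) ≠ 0 := by exact_mod_cast hd.ne'
  let v : Fin d × Fin d → Fin d × Fin d → ℂ := fun p x => embedU dS d h US (x.2, p.1) (x.1, p.2)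
  let u : Fin d × Fin d → Fin d × Fin d → ℂ := fun p x => extU dS d US x.2 p.1 x.1 p.2
  let G : Finset (Fin d × Fin d) := Finset.univ.filter fun p => p.1 ≠ p.2 ∧ p.1.val < dS ∧ p.2.val < dS
  let R : Matrix (Fin d × Fin d) (Fin d × Fin d) ℂ :=
    diagonal fun x => if x.1.val < dS ∧ x.2.val < dS then 0 else 1
  let P : Matrix (Fin d × Fin d) (Fin d × Fin d) ℂ :=
    ((d : ℂ) * d)⁻¹ • ∑ p ∈ Gᶜ, vecMulVec (v p) (star (v p))
  let Q : Matrix (Fin d × Fin d) (Fin d × Fin d) ℂ :=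
    ((d : ℂ) * d)⁻¹ • (∑ p ∈ Gᶜ, vecMulVec (u p) (star (u p)) + R)
  have hc0 : (0 : ℂ) ≤ ((d : ℂ) * d)⁻¹ := by
    have : ((d : ℂ) * d)⁻¹ = (((d * d : ℝ)⁻¹ : ℝ) : ℂ) := by push_cast; rfl
    rw [this]
    exact Complex.zero_le_real.2 (by positivity)
  have hP : P.PosSemidef :=
    Matrix.PosSemidef.smul (Matrix.posSemidef_sum _ fun p _ => posSemidef_vecMulVec_self_star _) hc0
  have hR : R.PosSemidef := by
    refine Matrix.PosSemidef.diagonal fun x => ?_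
    show (0 : ℂ) ≤ if x.1.val < dS ∧ x.2.val < dS then 0 else 1
    split_ifs <;> simp
  have hQ : Q.PosSemidef :=
    Matrix.PosSemidef.smul ((Matrix.posSemidef_sum _ fun p _ =>
      posSemidef_vecMulVec_self_star _).add hR) hc0
  have huv : ∀ p ∈ G, v p = u p := by
    rintro ⟨e, b⟩ hp
    have hne : e ≠ b := by simp [G] at hp; exact hp.1
    funext ⟨a, c⟩
    simp only [v, u, embedU_eq]
    rw [if_neg (by tauto), add_zero]
  have hall : ∑ p, vecMulVec (u p) (star (u p)) + R = 1 := by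
    ext ⟨a, c⟩ ⟨a', c'⟩
    have := ext_AC dS d h hpos US hUSp a c a' c'
    simp only [Matrix.add_apply, Matrix.sum_apply, vecMulVec_apply, Pi.star_apply, u,
      Fintype.sum_prod_type]
    rw [Finset.sum_comm, this]
    simp only [R, diagonal_apply, Matrix.one_apply, Prod.mk.injEq]
    by_cases h1 : a = a' ∧ c = c'
    · obtain ⟨rfl, rfl⟩ := h1
      by_cases h2 : a.val < dS ∧ c.val < dS <;> simp [h2]
    · simp [h1]
  have hrho : rhoAC (choiVec (embedU dS d h US)) =
      ((d : ℂ) * d)⁻¹ • ∑ p, vecMulVec (v p) (star (v p)) := by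
    ext ⟨a, c⟩ ⟨a', c'⟩
    rw [rhoAC_apply]
    simp only [Matrix.smul_apply, Matrix.sum_apply, vecMulVec_apply, Pi.star_apply, v,
      Fintype.sum_prod_type, smul_eq_mul]
    rw [Finset.sum_comm]
  have hmm : mmState (Fin d × Fin d) = ((d : ℂ) * d)⁻¹ • 1 := by
    simp [mmState]
  have hX : rhoAC (choiVec (embedU dS d h US)) - mmState (Fin d × Fin d) = P - Q := by
    rw [hrho, hmm, ← hall]
    simp only [P, Q]
    rw [← smul_sub, ← smul_sub]
    congr 1
    rw [← Finset.sum_add_sum_compl G, ← Finset.sum_add_sum_compl G (fun p => vecMulVec (u p) _),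
      Finset.sum_congr rfl (fun p hp => by rw [huv p hp])]
    abel
  have htr : (rhoAC (choiVec (embedU dS d h US))).trace = 1 := by
    simp only [Matrix.trace, Matrix.diag_apply, Fintype.sum_prod_type, rhoAC_apply]
    simp only [← Finset.mul_sum]
    have : ∀ a, ∑ c, ∑ b, ∑ e, embedU dS d h US (c, e) (a, b) *
        star (embedU dS d h US (c, e) (a, b)) = d := by
      intro a
      have := embed_cond dS d h hpos US hUSp a a
      simp only [if_true, Fintype.card_fin] at this
      rw [← this, Finset.sum_comm, Finset.sum_comm (γ := Fin d) (s := Finset.univ) (t := Finset.univ)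
        (f := fun e b => ∑ c, embedU dS d h US (c, e) (a, b) *
        star (embedU dS d h US (c, e) (a, b)))]
      exact Finset.sum_congr rfl fun b _ => Finset.sum_comm
    simp only [this]
    simp
    field_simp
  have htm : (mmState (Fin d × Fin d)).trace = 1 := by
    rw [hmm]; simp; field_simp
  have htPQ : P.trace = Q.trace := by
    have := congrArg Matrix.trace hX
    rw [Matrix.trace_sub, Matrix.trace_sub, htr, htm, sub_self] at this
    exact (sub_eq_zero.1 this.symm)
  have hRt : R.trace = (d : ℂ) * d - dS * dS := by
    have hcount : ∑ x : Fin d, (if x.val < dS then (1 : ℂ) else 0) = dS := by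
      rw [sum_castLE dS d h _ (fun x hx => if_neg hx)]
      simp
    obtain ⟨g, hg⟩ : ∃ g : Fin d → ℂ, ∀ x, g x = if x.val < dS then (1 : ℂ) else 0 :=
      ⟨_, fun _ => rfl⟩
    have : ∀ x : Fin d × Fin d, (if x.1.val < dS ∧ x.2.val < dS then (0 : ℂ) else 1) =
        1 - g x.1 * g x.2 := by
      intro x
      rw [hg, hg]
      by_cases h1 : x.1.val < dS <;> by_cases h2 : x.2.val < dS <;> simp [h1, h2]
    simp only [← hg] at hcount
    simp only [R, Matrix.trace, Matrix.diag_apply, diagonal_apply_eq, this,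
      Finset.sum_sub_distrib, Fintype.sum_prod_type]
    rw [← Finset.sum_mul_sum, hcount]
    simp
  have hut : (∑ p ∈ Gᶜ, vecMulVec (u p) (star (u p))).trace = dS := by
    have hcount : ∑ x : Fin d, (if x.val < dS then (1 : ℂ) else 0) = dS := by
      rw [sum_castLE dS d h _ (fun x hx => if_neg hx)]
      simp
    have e1 : ∀ p : Fin d × Fin d, (if p ∈ Gᶜ then (vecMulVec (u p) (star (u p))).trace else 0) =
        if p.1 = p.2 then (if p.2.val < dS then 1 else 0) else 0 := by
      rintro ⟨e, b⟩
      by_cases heb : e = b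
      · subst heb
        have := ext_BD dS d h hpos US hUSp e
        rw [if_pos (by simp [G]), if_pos rfl, ← this]
        simp only [Matrix.trace, Matrix.diag_apply, vecMulVec_apply, Pi.star_apply, u,
          Fintype.sum_prod_type]
      · rw [if_neg heb]
        split_ifs with hp
        · have : ¬ (e.val < dS ∧ b.val < dS) := by
            simp only [G, Finset.mem_compl, Finset.mem_filter, Finset.mem_univ, true_and] at hp
            tauto
          simp only [Matrix.trace, Matrix.diag_apply, vecMulVec_apply, Pi.star_apply, u]
          refine Finset.sum_eq_zero fun x _ => ?_
          rw [extU_zero _ _ _ _ _ _ _ (by tauto), zero_mul]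
        · rfl
    rw [Matrix.trace_sum, ← Finset.sum_ite_mem_eq, Finset.sum_congr rfl fun p _ => e1 p,
      Fintype.sum_prod_type]
    simpa using hcount
  have hQt : Q.trace.re = ((d : ℝ) * d)⁻¹ * (dS + (d * d - dS * dS)) := by
    have : Q.trace = ((((d : ℝ) * d)⁻¹ * (dS + (d * d - dS * dS)) : ℝ) : ℂ) := by
      simp only [Q]
      rw [Matrix.trace_smul, Matrix.trace_add, hut, hRt]
      push_cast
      rfl
    rw [this, Complex.ofReal_re]
  rw [hX]
  refine (traceNorm_sub_le P Q hP hQ).trans ?_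
  rw [htPQ, hQt, Nat.cast_sub h]
  have hdr : (0 : ℝ) < d := by exact_mod_cast hd
  have hsr : (0 : ℝ) ≤ dS := by positivity
  have hds : (dS : ℝ) + 1 ≤ d := by exact_mod_cast hlt
  have : 8 * ((d : ℝ) - dS) / d = ((d : ℝ) * d)⁻¹ * (8 * (d - dS) * d) := by
    field_simp
  rw [this, ← mul_add]
  refine mul_le_mul_of_nonneg_left ?_ (by positivity)
  nlinarith [mul_nonneg hsr (sub_nonneg.2 hds), mul_nonneg hdr.le (sub_nonneg.2 hds)]

/-- For `U_d` with `d_S ≤ d` odd and `d₀ = d - d_S`: (i) the reduced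
Choi state on `AD` is maximally mixed; (ii) `‖ρ_{AC} - τ_{AC}‖₁ ≤ 8 d₀ / d`; (iii) if
`d_S < d` the residual channel is at diamond distance at least `2 - 2/d` from the
completely depolarizing channel. -/
theorem lemma_nonrobust_maximal (dS d : ℕ) (h : dS ≤ d) (hodd : Odd dS)
    (US : Matrix (Fin dS × Fin dS) (Fin dS × Fin dS) ℂ)
    (hUSu : IsUnitaryMat US) (hUSp : PerfectTensor US) :
    rhoAD (choiVec (embedU dS d h US)) = mmState (Fin d × Fin d) ∧
    traceNorm (rhoAC (choiVec (embedU dS d h US)) - mmState (Fin d × Fin d)) ≤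
      8 * ((d - dS : ℕ) : ℝ) / d ∧
    (dS < d →
      2 - 2 / (d : ℝ) ≤
        diamondDist (residual (embedU dS d h US)) (depol (Fin d) (Fin d))) := by
  have hpos : 0 < dS := hodd.pos
  refine ⟨part1 dS d h hpos US hUSp, ?_, fun hlt => part3 dS d h hpos US hUSp hlt⟩
  rcases h.lt_or_eq with hlt | heq
  · exact part2 dS d h hpos US hUSp hlt
  · subst heq
    have hE : embedU dS dS h US = US := by
      ext ⟨c, e⟩ ⟨a, b⟩
      simp [embedU]
    rw [hE, hUSp.2.1, sub_self, ← sub_self (0 : Matrix (Fin dS × Fin dS) (Fin dS × Fin dS) ℂ)]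
    refine (traceNorm_sub_le _ _ Matrix.PosSemidef.zero Matrix.PosSemidef.zero).trans ?_
    simp

end Scrambling

end
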